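/- arXiv:2505.12195 — 4 statements merged into one kernel-verified Lean document; each statement's English description precedes it below -/
import Mathlib

section
/- Let (ρ̄, Ū1, Ū2, S̄, Ē) be a C¹ solution of the background system on [r0, r1] with ρ̄(r) > 0, Ū1(r) > 0, and c̄²(r) ≠ Ū1²(r) for all r ∈ [r0, r1]. Then (ρ̄, Ē) solves the reduced system: ρ̄'(r) = ρ̄(r)(Ū1²(r) + Ū2²(r) + r Ē(r))/(r (c̄²(r) − Ū1²(r))) and (r Ē)'(r) = r (ρ̄(r) − b0) for all r ∈ [r0, r1], where Ū1(r) = J1/(r ρ̄(r)) and Ū2(r) = J2/r. -/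
open Real Set

/-- The background ODE system for cylindrically symmetric Euler–Poisson flows on
`[r0, r1]`, for `C¹` functions `(ρ, U1, U2, S, E)`, with the entrance data at `r = r0`. -/
def IsBackgroundSolutionC1 (γ b0 r0 r1 ρ0 U10 U20 S0 E0 : ℝ)
    (ρ U1 U2 S E : ℝ → ℝ) : Prop :=
  ContDiffOn ℝ 1 ρ (Icc r0 r1) ∧
  ContDiffOn ℝ 1 U1 (Icc r0 r1) ∧
  ContDiffOn ℝ 1 U2 (Icc r0 r1) ∧
  ContDiffOn ℝ 1 S (Icc r0 r1) ∧
  ContDiffOn ℝ 1 E (Icc r0 r1) ∧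
  (∀ r ∈ Icc r0 r1, derivWithin (fun s => s * ρ s * U1 s) (Icc r0 r1) r = 0) ∧
  (∀ r ∈ Icc r0 r1,
    U1 r * derivWithin U1 (Icc r0 r1) r
      + derivWithin (fun s => Real.exp (S s) * ρ s ^ γ) (Icc r0 r1) r / ρ r
      - (U2 r) ^ 2 / r = E r) ∧
  (∀ r ∈ Icc r0 r1, U1 r * derivWithin U2 (Icc r0 r1) r + U1 r * U2 r / r = 0) ∧
  (∀ r ∈ Icc r0 r1, U1 r * derivWithin S (Icc r0 r1) r = 0) ∧
  (∀ r ∈ Icc r0 r1, derivWithin E (Icc r0 r1) r + E r / r = ρ r - b0) ∧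
  ρ r0 = ρ0 ∧ U1 r0 = U10 ∧ U2 r0 = U20 ∧ S r0 = S0 ∧ E r0 = E0

/-- A `C¹` solution of the background system with `ρ > 0`, `U1 > 0` and
`c̄² ≠ Ū1²` on `[r0, r1]` satisfies the reduced ODE system:
`Ū1 = J1/(r ρ̄)`, `Ū2 = J2/r`, `ρ̄' = ρ̄ (Ū1² + Ū2² + r Ē)/(r (c̄² − Ū1²))` and
`(r Ē)' = r (ρ̄ − b0)`, where `J1 = r0 ρ0 U10`, `J2 = r0 U20`,
`c̄²(r) = γ e^{S0} ρ̄(r)^{γ−1}`. -/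
theorem background_reduced_system
    (γ r0 r1 b0 ρ0 U10 U20 S0 E0 : ℝ)
    (hγ : 1 < γ) (hr0 : 0 < r0) (hr01 : r0 < r1) (hb0 : 0 < b0)
    (hρ0 : 0 < ρ0) (hU10 : 0 < U10) (hU20 : U20 ≠ 0) (hS0 : 0 < S0) (hE0 : 0 < E0)
    (ρ U1 U2 S E : ℝ → ℝ)
    (hsol : IsBackgroundSolutionC1 γ b0 r0 r1 ρ0 U10 U20 S0 E0 ρ U1 U2 S E)
    (hρpos : ∀ r ∈ Icc r0 r1, 0 < ρ r)
    (hU1pos : ∀ r ∈ Icc r0 r1, 0 < U1 r)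
    (hnonsonic : ∀ r ∈ Icc r0 r1,
      γ * Real.exp S0 * ρ r ^ (γ - 1) ≠ (U1 r) ^ 2) :
    ∀ r ∈ Icc r0 r1,
      U1 r = (r0 * ρ0 * U10) / (r * ρ r) ∧
      U2 r = (r0 * U20) / r ∧
      derivWithin ρ (Icc r0 r1) r =
        ρ r * ((U1 r) ^ 2 + (U2 r) ^ 2 + r * E r)
          / (r * (γ * Real.exp S0 * ρ r ^ (γ - 1) - (U1 r) ^ 2)) ∧
      derivWithin (fun s => s * E s) (Icc r0 r1) r = r * (ρ r - b0) := by
  obtain ⟨hρc, hU1c, hU2c, hSc, hEc, hmass, hmom, hang, hent, hpois, rfl, rfl, rfl, rfl, rfl⟩ :=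
    hsol
  have hρd := hρc.differentiableOn one_ne_zero
  have hU1d := hU1c.differentiableOn one_ne_zero
  have hU2d := hU2c.differentiableOn one_ne_zero
  have hSd := hSc.differentiableOn one_ne_zero
  have hEd := hEc.differentiableOn one_ne_zero
  have hpos : ∀ r ∈ Icc r0 r1, 0 < r := fun r hr => hr0.trans_le hr.1
  have huniq : UniqueDiffOn ℝ (Icc r0 r1) := uniqueDiffOn_Icc hr01
  have hSconst : ∀ r ∈ Icc r0 r1, S r = S r0 :=
    constant_of_derivWithin_zero hSd fun r hr =>
      (mul_eq_zero.mp (hent r (Ico_subset_Icc_self hr))).resolve_left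
        (hU1pos r (Ico_subset_Icc_self hr)).ne'
  have hmassconst : ∀ r ∈ Icc r0 r1, r * ρ r * U1 r = r0 * ρ r0 * U1 r0 :=
    constant_of_derivWithin_zero ((differentiableOn_id.mul hρd).mul hU1d) fun r hr =>
      hmass r (Ico_subset_Icc_self hr)
  have hangconst : ∀ r ∈ Icc r0 r1, r * U2 r = r0 * U2 r0 := by
    refine constant_of_derivWithin_zero (differentiableOn_id.mul hU2d) fun r hr' => ?_
    have hr := Ico_subset_Icc_self hr'
    have hr_ne := (hpos r hr).ne'
    have hderiv := ((hasDerivWithinAt_id r _).mul (hU2d r hr).hasDerivWithinAt).derivWithin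
      (huniq r hr)
    refine hderiv.trans (mul_left_cancel₀ (hU1pos r hr).ne' ?_)
    have h := hang r hr
    field_simp at h
    simp only [id]
    linear_combination h
  intro r hr
  have hr_pos := hpos r hr
  have hρr := hρpos r hr
  have hρ' := (hρd r hr).hasDerivWithinAt
  have hU1' := (hU1d r hr).hasDerivWithinAt
  refine ⟨?_, ?_, ?_, ?_⟩
  · rw [eq_div_iff (by positivity), ← hmassconst r hr]
    ring
  · rw [eq_div_iff hr_pos.ne', ← hangconst r hr]
    ring
  · have hmass' : (1 * ρ r + r * derivWithin ρ (Icc r0 r1) r) * U1 r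
        + r * ρ r * derivWithin U1 (Icc r0 r1) r = 0 :=
      ((((hasDerivWithinAt_id r _).mul hρ').mul hU1').derivWithin (huniq r hr)).symm.trans
        (hmass r hr)
    have hpressure : derivWithin (fun s => Real.exp (S s) * ρ s ^ γ) (Icc r0 r1) r
        = Real.exp (S r0) * (derivWithin ρ (Icc r0 r1) r * γ * ρ r ^ (γ - 1)) := by
      rw [derivWithin_congr (f := fun s => Real.exp (S r0) * ρ s ^ γ)
        (fun s hs => by simp only [hSconst s hs]) (by simp only [hSconst r hr])]
      exact ((hρ'.rpow_const (Or.inl hρr.ne')).const_mul _).derivWithin (huniq r hr)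
    have hmom' := hmom r hr
    rw [hpressure] at hmom'
    have hne : γ * Real.exp (S r0) * ρ r ^ (γ - 1) - U1 r ^ 2 ≠ 0 :=
      sub_ne_zero.mpr (hnonsonic r hr)
    rw [eq_div_iff (mul_ne_zero hr_pos.ne' hne)]
    generalize ρ r ^ (γ - 1) = c at *
    field_simp at hmom'
    linear_combination hmom' - U1 r * hmass'
  · have hderiv := ((hasDerivWithinAt_id r _).mul (hEd r hr).hasDerivWithinAt).derivWithin
      (huniq r hr)
    refine hderiv.trans ?_
    rw [← hpois r hr]
    simp only [id]
    field_simp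
    ring
end

section
/- Let (ρ̄, Ē) be a C¹ solution of the reduced system on an interval I with ρ̄(r) > 0 and c̄²(r) ≠ Ū1²(r) for all r ∈ I. Then the squared radial Mach number satisfies the identity (M̄1²)'(r) = −(M̄1²(r)/(r(1 − M̄1²(r)))) · ((γ−1) M̄1²(r) + (γ+1) M̄2²(r) + (γ+1) r Ē(r)/c̄²(r) + 2) for all r ∈ I. -/
open Real Set

/-- Radial velocity `Ū1(r) = J1/(r ρ̄(r))` of the background flow. -/
noncomputable def Ubar1 (J1 : ℝ) (ρ : ℝ → ℝ) (r : ℝ) : ℝ := J1 / (r * ρ r)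

/-- Angular velocity `Ū2(r) = J2/r` of the background flow. -/
noncomputable def Ubar2 (J2 r : ℝ) : ℝ := J2 / r

/-- Squared sound speed `c̄²(r) = γ e^{S0} ρ̄(r)^{γ−1}`. -/
noncomputable def csq (γ S0 : ℝ) (ρ : ℝ → ℝ) (r : ℝ) : ℝ :=
  γ * Real.exp S0 * ρ r ^ (γ - 1)

/-- Squared radial Mach number `M̄1²(r) = Ū1²(r)/c̄²(r)`. -/
noncomputable def M1sq (γ S0 J1 : ℝ) (ρ : ℝ → ℝ) (r : ℝ) : ℝ :=
  (Ubar1 J1 ρ r) ^ 2 / csq γ S0 ρ r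

/-- Squared angular Mach number `M̄2²(r) = Ū2²(r)/c̄²(r)`. -/
noncomputable def M2sq (γ S0 J2 : ℝ) (ρ : ℝ → ℝ) (r : ℝ) : ℝ :=
  (Ubar2 J2 r) ^ 2 / csq γ S0 ρ r

/-- The reduced ODE system for `(ρ̄, Ē)` on the interval `[r0, r1]`:
`ρ̄'(r) = ρ̄(r)(Ū1² + Ū2² + r Ē)/(r (c̄² − Ū1²))` and `(r Ē)'(r) = r (ρ̄(r) − b0)`,
for `C¹` functions `ρ, E`. -/
def ReducedSystem (γ S0 b0 J1 J2 r0 r1 : ℝ) (ρ E : ℝ → ℝ) : Prop :=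
  ContDiffOn ℝ 1 ρ (Icc r0 r1) ∧ ContDiffOn ℝ 1 E (Icc r0 r1) ∧
  (∀ r ∈ Icc r0 r1,
    derivWithin ρ (Icc r0 r1) r =
      ρ r * ((Ubar1 J1 ρ r) ^ 2 + (Ubar2 J2 r) ^ 2 + r * E r)
        / (r * (csq γ S0 ρ r - (Ubar1 J1 ρ r) ^ 2))) ∧
  (∀ r ∈ Icc r0 r1, derivWithin (fun s => s * E s) (Icc r0 r1) r = r * (ρ r - b0))

/-- The derivative of the squared sound speed along a density profile. -/
theorem hasDerivWithinAt_csq {γ S0 d r : ℝ} {ρ : ℝ → ℝ} {s : Set ℝ}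
    (hρ : HasDerivWithinAt ρ d s r) (hpos : 0 < ρ r) :
    HasDerivWithinAt (csq γ S0 ρ) ((γ - 1) * csq γ S0 ρ r * d / ρ r) s r := by
  have h := (hρ.rpow_const (p := γ - 1) (Or.inl hpos.ne')).const_mul (γ * Real.exp S0)
  refine h.congr_deriv ?_
  rw [Real.rpow_sub_one hpos.ne']
  unfold csq
  ring

/-- The derivative of the radial velocity along a density profile. -/
theorem hasDerivWithinAt_Ubar1 {J1 d r : ℝ} {ρ : ℝ → ℝ} {s : Set ℝ}
    (hρ : HasDerivWithinAt ρ d s r) (hr : r ≠ 0) (hρr : ρ r ≠ 0) :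
    HasDerivWithinAt (Ubar1 J1 ρ) (-Ubar1 J1 ρ r * (1 / r + d / ρ r)) s r := by
  have h := (hasDerivWithinAt_const r s J1).fun_div ((hasDerivWithinAt_id r s).fun_mul hρ)
    (mul_ne_zero hr hρr)
  refine h.congr_deriv ?_
  simp only [Ubar1, id]
  field_simp
  ring

/-- The derivative of the squared radial Mach number along a density profile. -/
theorem hasDerivWithinAt_M1sq {γ S0 J1 d r : ℝ} {ρ : ℝ → ℝ} {s : Set ℝ}
    (hρ : HasDerivWithinAt ρ d s r) (hr : r ≠ 0) (hpos : 0 < ρ r) (hc : csq γ S0 ρ r ≠ 0) :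
    HasDerivWithinAt (M1sq γ S0 J1 ρ)
      (-M1sq γ S0 J1 ρ r * (2 / r + (γ + 1) * (d / ρ r))) s r := by
  have h := ((hasDerivWithinAt_Ubar1 (J1 := J1) hρ hr hpos.ne').fun_pow 2).fun_div
    (hasDerivWithinAt_csq hρ hpos) hc
  refine h.congr_deriv ?_
  have hρr := hpos.ne'
  simp only [M1sq]
  field_simp
  push_cast
  ring

/-- For a `C¹` solution of the reduced system with `ρ̄ > 0` and `c̄² ≠ Ū1²`, the squared
radial Mach number satisfies
`(M̄1²)' = −(M̄1²/(r(1 − M̄1²))) ((γ−1) M̄1² + (γ+1) M̄2² + (γ+1) r Ē/c̄² + 2)`. -/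
theorem M1sq_derivative_identity
    (γ r0 r1 b0 J1 J2 S0 : ℝ)
    (hγ : 1 < γ) (hr0 : 0 < r0) (hr01 : r0 < r1) (hb0 : 0 < b0)
    (hJ1 : 0 < J1) (hJ2 : J2 ≠ 0) (hS0 : 0 < S0)
    (ρ E : ℝ → ℝ)
    (hsol : ReducedSystem γ S0 b0 J1 J2 r0 r1 ρ E)
    (hρpos : ∀ r ∈ Icc r0 r1, 0 < ρ r)
    (hnonsonic : ∀ r ∈ Icc r0 r1, csq γ S0 ρ r ≠ (Ubar1 J1 ρ r) ^ 2) :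
    ∀ r ∈ Icc r0 r1,
      derivWithin (fun s => M1sq γ S0 J1 ρ s) (Icc r0 r1) r =
        -(M1sq γ S0 J1 ρ r / (r * (1 - M1sq γ S0 J1 ρ r))) *
          ((γ - 1) * M1sq γ S0 J1 ρ r + (γ + 1) * M2sq γ S0 J2 ρ r
            + (γ + 1) * (r * E r) / csq γ S0 ρ r + 2) := by
  intro r hr
  obtain ⟨hρ, -, hode, -⟩ := hsol
  have hr' : r ≠ 0 := (hr0.trans_le hr.1).ne'
  have hpos := hρpos r hr
  have hρr := hpos.ne'
  have hc : csq γ S0 ρ r ≠ 0 := by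
    unfold csq
    have := Real.rpow_pos_of_pos hpos (γ - 1)
    positivity
  have hd := ((hρ.differentiableOn one_ne_zero) r hr).hasDerivWithinAt
  rw [(hasDerivWithinAt_M1sq (J1 := J1) hd hr' hpos hc).derivWithin
    (uniqueDiffOn_Icc hr01 r hr), hode r hr]
  have hns := sub_ne_zero.2 (hnonsonic r hr)
  have hM : 1 - M1sq γ S0 J1 ρ r = (csq γ S0 ρ r - Ubar1 J1 ρ r ^ 2) / csq γ S0 ρ r := by
    rw [M1sq, sub_div, div_self hc]
  rw [hM, M1sq, M2sq]
  field_simp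
  ring
end

section
/- Let (ρ̄, Ē) be a C¹ solution of the reduced system on [r0, r0 + R1] with ρ̄(r) > 0 and c̄²(r) ≠ Ū1²(r) for all r, with r Ē(r) > 0 for all r ∈ [r0, r0 + R1], and with M̄1²(r0) < 1. Then M̄1²(r) ≤ M̄1²(r0) < 1 for all r ∈ [r0, r0 + R1]; in particular the flow remains subsonic in the radial direction. -/
open Real Set

/-- A continuous function on `[a, b]` that never vanishes and is positive at `a` is positive. -/
lemma ContinuousOn.pos_of_ne_zero_of_pos_left {f : ℝ → ℝ} {a b : ℝ}
    (hf : ContinuousOn f (Icc a b)) (hne : ∀ x ∈ Icc a b, f x ≠ 0) (ha : 0 < f a) :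
    ∀ x ∈ Icc a b, 0 < f x := by
  intro x hx
  by_contra! h
  obtain ⟨y, hy, hy0⟩ :=
    intermediate_value_Icc' hx.1 (hf.mono (Icc_subset_Icc_right hx.2)) ⟨h, ha.le⟩
  exact hne y ⟨hy.1, hy.2.trans hx.2⟩ hy0

lemma csq_pos {γ S0 r : ℝ} {ρ : ℝ → ℝ} (hγ : 0 < γ) (hρ : 0 < ρ r) : 0 < csq γ S0 ρ r := by
  unfold csq
  positivity

/-- The squared radial Mach number decreases when both the radius and the density increase. -/
lemma M1sq_le_M1sq {γ S0 J1 r s : ℝ} {ρ : ℝ → ℝ} (hγ : 1 ≤ γ) (hJ1 : 0 ≤ J1) (hr : 0 < r)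
    (hrs : r ≤ s) (hρ : 0 < ρ r) (hρrs : ρ r ≤ ρ s) :
    M1sq γ S0 J1 ρ s ≤ M1sq γ S0 J1 ρ r := by
  have hγ0 : 0 < γ := by linarith
  have hs : 0 < s := hr.trans_le hrs
  have hU : Ubar1 J1 ρ s ≤ Ubar1 J1 ρ r := by
    unfold Ubar1
    gcongr
  have hU0 : 0 ≤ Ubar1 J1 ρ s := by
    have := hρ.trans_le hρrs
    unfold Ubar1
    positivity
  have hc : csq γ S0 ρ r ≤ csq γ S0 ρ s := by
    unfold csq
    have := rpow_le_rpow hρ.le hρrs (sub_nonneg.2 hγ)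
    gcongr
  exact div_le_div₀ (by positivity) (pow_le_pow_left₀ hU0 hU 2) (csq_pos hγ0 hρ) hc

/-- If `(ρ̄, Ē)` solves the reduced system on `[r0, r0 + R1]` with `ρ̄ > 0`,
`c̄² ≠ Ū1²`, `r Ē > 0` and `M̄1²(r0) < 1`, then `M̄1²(r) ≤ M̄1²(r0) < 1` on
`[r0, r0 + R1]`: the flow remains subsonic in the radial direction. -/
theorem M1sq_decreasing_subsonic
    (γ r0 b0 J1 J2 S0 R1 : ℝ)
    (hγ : 1 < γ) (hr0 : 0 < r0) (hR1 : 0 < R1) (hb0 : 0 < b0)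
    (hJ1 : 0 < J1) (hJ2 : J2 ≠ 0) (hS0 : 0 < S0)
    (ρ E : ℝ → ℝ)
    (hsol : ReducedSystem γ S0 b0 J1 J2 r0 (r0 + R1) ρ E)
    (hρpos : ∀ r ∈ Icc r0 (r0 + R1), 0 < ρ r)
    (hnonsonic : ∀ r ∈ Icc r0 (r0 + R1), csq γ S0 ρ r ≠ (Ubar1 J1 ρ r) ^ 2)
    (hrE : ∀ r ∈ Icc r0 (r0 + R1), 0 < r * E r)
    (hM1init : M1sq γ S0 J1 ρ r0 < 1) :
    ∀ r ∈ Icc r0 (r0 + R1),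
      M1sq γ S0 J1 ρ r ≤ M1sq γ S0 J1 ρ r0 ∧ M1sq γ S0 J1 ρ r < 1 := by
  have hγ0 : 0 < γ := by linarith
  obtain ⟨hρ, -, hρ', -⟩ := hsol
  have hr0mem : r0 ∈ Icc r0 (r0 + R1) := left_mem_Icc.2 (by linarith)
  have hpos : ∀ r ∈ Icc r0 (r0 + R1), 0 < r := fun r hr => hr0.trans_le hr.1
  have hcont : ContinuousOn (fun r => csq γ S0 ρ r - (Ubar1 J1 ρ r) ^ 2) (Icc r0 (r0 + R1)) := by
    unfold csq Ubar1
    have hρc := hρ.continuousOn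
    refine (continuousOn_const.mul
      (hρc.rpow_const fun r hr => Or.inl (hρpos r hr).ne')).sub (ContinuousOn.pow ?_ 2)
    exact continuousOn_const.div (continuousOn_id.mul hρc)
      fun r hr => (mul_pos (hpos r hr) (hρpos r hr)).ne'
  have hsub : ∀ r ∈ Icc r0 (r0 + R1), 0 < csq γ S0 ρ r - (Ubar1 J1 ρ r) ^ 2 := by
    refine hcont.pos_of_ne_zero_of_pos_left (fun r hr => sub_ne_zero.2 (hnonsonic r hr)) ?_
    exact sub_pos.2 ((div_lt_one (csq_pos hγ0 (hρpos r0 hr0mem))).1 hM1init)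
  have hmono : MonotoneOn ρ (Icc r0 (r0 + R1)) := by
    refine monotoneOn_of_hasDerivWithinAt_nonneg (convex_Icc _ _) hρ.continuousOn
      (f' := derivWithin ρ (Icc r0 (r0 + R1))) (fun r hr => ?_) fun r hr => ?_
    · exact ((hρ.differentiableOn one_ne_zero r (interior_subset hr)).hasDerivWithinAt).mono
        interior_subset
    · replace hr := interior_subset hr
      rw [hρ' r hr]
      have h1 := hρpos r hr
      have h2 := hpos r hr
      have h3 := hsub r hr
      have h4 := hrE r hr
      positivity
  intro r hr
  have hle := M1sq_le_M1sq (S0 := S0) hγ.le hJ1.le hr0 hr.1 (hρpos r0 hr0mem)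
    (hmono hr0mem hr hr.1)
  exact ⟨hle, hle.trans_lt hM1init⟩
end

section
/- Let 0 < r0 < r1 and let V1, V2 : [r0, r1] × ℝ → ℝ be C¹ functions, 2π-periodic in the second variable θ, satisfying the irrotationality relation ∂_r(r V2)(r, θ) = ∂_θ V1(r, θ) for all (r, θ). Set d0 = −(1/(2π)) ∫_0^{2π} r0 V2(r0, s) ds and define ψ(r, θ) = ∫_{r0}^{r} V1(s, θ) ds + ∫_0^{θ} (r0 V2(r0, s) + d0) ds. Then ψ(r, θ + 2π) = ψ(r, θ) for all (r, θ), and ψ is a potential in the sense that ∂_r ψ(r, θ) = V1(r, θ) and ∂_θ ψ(r, θ) = r V2(r, θ) + d0 for all (r, θ) ∈ [r0, r1] × ℝ. -/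
open Real Set MeasureTheory

/-- The partial derivative `∂_r f` of a function of `(r, θ)`. -/
noncomputable def pdr (f : ℝ × ℝ → ℝ) (p : ℝ × ℝ) : ℝ := fderiv ℝ f p (1, 0)

/-- The partial derivative `∂_θ f` of a function of `(r, θ)`. -/
noncomputable def pdt (f : ℝ × ℝ → ℝ) (p : ℝ × ℝ) : ℝ := fderiv ℝ f p (0, 1)

open Filter Topology

theorem HasFDerivAt.hasDerivAt_slice_fst {f : ℝ × ℝ → ℝ} {f' : ℝ × ℝ →L[ℝ] ℝ} {r θ : ℝ}
    (h : HasFDerivAt f f' (r, θ)) : HasDerivAt (fun s => f (s, θ)) (f' (1, 0)) r :=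
  h.comp_hasDerivAt r ((hasDerivAt_id r).prodMk (hasDerivAt_const r θ))

theorem HasFDerivAt.hasDerivAt_slice_snd {f : ℝ × ℝ → ℝ} {f' : ℝ × ℝ →L[ℝ] ℝ} {r θ : ℝ}
    (h : HasFDerivAt f f' (r, θ)) : HasDerivAt (fun t => f (r, t)) (f' (0, 1)) θ :=
  h.comp_hasDerivAt θ ((hasDerivAt_const θ r).prodMk (hasDerivAt_id θ))

theorem ContDiff.hasDerivAt_pdr {f : ℝ × ℝ → ℝ} (hf : ContDiff ℝ 1 f) (r θ : ℝ) :
    HasDerivAt (fun s => f (s, θ)) (pdr f (r, θ)) r :=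
  (hf.differentiable one_ne_zero (r, θ)).hasFDerivAt.hasDerivAt_slice_fst

theorem ContDiff.hasDerivAt_pdt {f : ℝ × ℝ → ℝ} (hf : ContDiff ℝ 1 f) (r θ : ℝ) :
    HasDerivAt (fun t => f (r, t)) (pdt f (r, θ)) θ :=
  (hf.differentiable one_ne_zero (r, θ)).hasFDerivAt.hasDerivAt_slice_snd

theorem ContDiff.continuous_pdr {f : ℝ × ℝ → ℝ} (hf : ContDiff ℝ 1 f) : Continuous (pdr f) :=
  (hf.continuous_fderiv one_ne_zero).clm_apply continuous_const

theorem ContDiff.continuous_pdt {f : ℝ × ℝ → ℝ} (hf : ContDiff ℝ 1 f) : Continuous (pdt f) :=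
  (hf.continuous_fderiv one_ne_zero).clm_apply continuous_const

/-- Differentiation under the integral sign for a `C¹` integrand on a compact interval. -/
theorem ContDiff.hasDerivAt_intervalIntegral_snd {f : ℝ × ℝ → ℝ} (hf : ContDiff ℝ 1 f)
    (a b θ : ℝ) :
    HasDerivAt (fun t => ∫ s in a..b, f (s, t)) (∫ s in a..b, pdt f (s, θ)) θ := by
  have hc := hf.continuous
  have hd := hf.continuous_pdt
  obtain ⟨C, hC⟩ := (isCompact_uIcc.prod (isCompact_closedBall θ 1)).exists_bound_of_continuousOn
    (s := uIcc a b ×ˢ Metric.closedBall θ 1) hd.continuousOn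
  refine (intervalIntegral.hasDerivAt_integral_of_dominated_loc_of_deriv_le
    (F := fun t s => f (s, t)) (F' := fun t s => pdt f (s, t)) (bound := fun _ => C)
    (Metric.closedBall_mem_nhds θ one_pos)
    (Eventually.of_forall fun t => ?_) ?_ ?_ ?_ intervalIntegrable_const ?_).2
  · exact (by fun_prop : Continuous fun s => f (s, t)).aestronglyMeasurable
  · exact (by fun_prop : Continuous fun s => f (s, θ)).intervalIntegrable _ _
  · exact (by fun_prop : Continuous fun s => pdt f (s, θ)).aestronglyMeasurable
  · exact ae_of_all _ fun s hs t ht => hC (s, t) ⟨uIoc_subset_uIcc hs, ht⟩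
  · exact ae_of_all _ fun s _ t _ => hf.hasDerivAt_pdt s t

/-- A function on the plane with continuous partial derivatives is differentiable. -/
theorem differentiable_of_continuous_partials {f g h : ℝ × ℝ → ℝ}
    (hg : Continuous g) (hh : Continuous h)
    (hfst : ∀ r θ, HasDerivAt (fun s => f (s, θ)) (g (r, θ)) r)
    (hsnd : ∀ r θ, HasDerivAt (fun t => f (r, t)) (h (r, θ)) θ) :
    Differentiable ℝ f := fun p =>
  (hasStrictFDerivAt_uncurry_coprod (𝕜 := ℝ) (u := p) (f := fun r θ => f (r, θ))
    (f₁ := fun r θ => ContinuousLinearMap.toSpanSingleton ℝ (g (r, θ)))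
    (f₂ := fun r θ => ContinuousLinearMap.toSpanSingleton ℝ (h (r, θ)))
    (Eventually.of_forall fun v => (hfst v.1 v.2).hasFDerivAt)
    (Eventually.of_forall fun v => (hsnd v.1 v.2).hasFDerivAt)
    ((ContinuousLinearMap.toSpanSingletonCLE (𝕜 := ℝ) (E := ℝ)).continuous.comp hg).continuousAt
    ((ContinuousLinearMap.toSpanSingletonCLE (𝕜 := ℝ) (E := ℝ)).continuous.comp hh).continuousAt
    ).hasFDerivAt.differentiableAt

theorem pdr_eq_of_hasDerivAt {f : ℝ × ℝ → ℝ} {p : ℝ × ℝ} {c : ℝ} (hf : DifferentiableAt ℝ f p)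
    (h : HasDerivAt (fun s => f (s, p.2)) c p.1) : pdr f p = c :=
  hf.hasFDerivAt.hasDerivAt_slice_fst.unique h

theorem pdt_eq_of_hasDerivAt {f : ℝ × ℝ → ℝ} {p : ℝ × ℝ} {c : ℝ} (hf : DifferentiableAt ℝ f p)
    (h : HasDerivAt (fun t => f (p.1, t)) c p.2) : pdt f p = c :=
  hf.hasFDerivAt.hasDerivAt_slice_snd.unique h

/-- Construction of the 2π-periodic potential of an irrotational velocity perturbation
`(V1, V2)` on the annulus `[r0, r1] × ℝ`: with
`d0 = −(1/2π) ∫₀^{2π} r0 V2(r0, s) ds` and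
`ψ(r, θ) = ∫_{r0}^r V1(s, θ) ds + ∫₀^θ (r0 V2(r0, s) + d0) ds`,
the function `ψ` is 2π-periodic in `θ`, `∂_r ψ = V1` and `∂_θ ψ = r V2 + d0`. -/
theorem periodic_potential_exists
    (r0 r1 : ℝ) (hr0 : 0 < r0) (hr01 : r0 < r1)
    (V1 V2 : ℝ × ℝ → ℝ) (hV1 : ContDiff ℝ 1 V1) (hV2 : ContDiff ℝ 1 V2)
    (hV1per : ∀ p : ℝ × ℝ, V1 (p.1, p.2 + 2 * π) = V1 p)
    (hV2per : ∀ p : ℝ × ℝ, V2 (p.1, p.2 + 2 * π) = V2 p)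
    (hirr : ∀ p : ℝ × ℝ, p.1 ∈ Icc r0 r1 →
      pdr (fun q => q.1 * V2 q) p = pdt V1 p)
    (d0 : ℝ)
    (hd0 : d0 = -(1 / (2 * π)) * ∫ s in (0 : ℝ)..(2 * π), r0 * V2 (r0, s))
    (ψ : ℝ × ℝ → ℝ)
    (hψdef : ∀ p : ℝ × ℝ,
      ψ p = (∫ s in r0..p.1, V1 (s, p.2))
          + ∫ s in (0 : ℝ)..p.2, (r0 * V2 (r0, s) + d0)) :
    (∀ p : ℝ × ℝ, ψ (p.1, p.2 + 2 * π) = ψ p) ∧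
    (∀ p : ℝ × ℝ, p.1 ∈ Icc r0 r1 →
      pdr ψ p = V1 p ∧ pdt ψ p = p.1 * V2 p + d0) := by
  have hcV1 := hV1.continuous
  have hcV2 := hV2.continuous
  have hdV1 := hV1.continuous_pdt
  have hW : ContDiff ℝ 1 fun q : ℝ × ℝ => q.1 * V2 q := contDiff_fst.mul hV2
  have hB : Continuous fun s => r0 * V2 (r0, s) + d0 := by fun_prop
  have hBper : Function.Periodic (fun s => r0 * V2 (r0, s) + d0) (2 * π) := fun s => by
    simp only [hV2per (r0, s)]
  have hBzero : ∫ s in (0 : ℝ)..(0 + 2 * π), (r0 * V2 (r0, s) + d0) = 0 := by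
    rw [zero_add, intervalIntegral.integral_add
      ((by fun_prop : Continuous fun s => r0 * V2 (r0, s)).intervalIntegrable _ _)
      intervalIntegrable_const, intervalIntegral.integral_const, hd0, smul_eq_mul]
    field_simp [Real.pi_ne_zero]
    ring
  have hfst : ∀ r θ, HasDerivAt (fun s => ψ (s, θ)) (V1 (r, θ)) r := fun r θ => by
    simp only [hψdef]
    exact ((by fun_prop : Continuous fun s => V1 (s, θ)).integral_hasStrictDerivAt
      r0 r).hasDerivAt.add_const _
  have hsnd : ∀ r θ, HasDerivAt (fun t => ψ (r, t))
      ((∫ s in r0..r, pdt V1 (s, θ)) + (r0 * V2 (r0, θ) + d0)) θ := fun r θ => by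
    simp only [hψdef]
    exact (hV1.hasDerivAt_intervalIntegral_snd r0 r θ).add
      (hB.integral_hasStrictDerivAt 0 θ).hasDerivAt
  have hψ : Differentiable ℝ ψ := differentiable_of_continuous_partials
    (h := fun p => (∫ s in r0..p.1, pdt V1 (s, p.2)) + (r0 * V2 (r0, p.2) + d0))
    hcV1 (by fun_prop) hfst hsnd
  refine ⟨fun p => ?_, fun p hp => ⟨pdr_eq_of_hasDerivAt (hψ p) (hfst _ _), ?_⟩⟩
  · simp only [hψdef, fun s => hV1per (s, p.2)]
    rw [hBper.intervalIntegral_add_eq_add 0 p.2 fun _ _ => hB.intervalIntegrable _ _,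
      hBzero, add_zero]
  · rw [pdt_eq_of_hasDerivAt (hψ p) (hsnd _ _)]
    have hint : ∫ s in r0..p.1, pdt V1 (s, p.2) = p.1 * V2 p - r0 * V2 (r0, p.2) := by
      rw [← intervalIntegral.integral_eq_sub_of_hasDerivAt
        (fun r _ => hW.hasDerivAt_pdr r p.2)
        ((hW.continuous_pdr.comp (by fun_prop : Continuous fun s => (s, p.2))).intervalIntegrable
          _ _)]
      refine intervalIntegral.integral_congr fun s hs => ?_
      rw [uIcc_of_le hp.1] at hs
      exact (hirr (s, p.2) ⟨hs.1, hs.2.trans hp.2⟩).symm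
    rw [hint]
    ring
end
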